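/- Every 3-regular graph on n vertices that has a Hamiltonian cycle admits a straight-line RAC drawing of O(n²) area. -/

import Mathlib

open scoped Classical

noncomputable section

/-- A point of the Euclidean plane. -/
abbrev Pt : Type := ℝ × ℝ

/-- The segments with endpoints `a, b` and `c, d` are orthogonal:
their direction vectors have zero inner product. -/
def SegOrth (a b c d : Pt) : Prop :=
  (b.1 - a.1) * (d.1 - c.1) + (b.2 - a.2) * (d.2 - c.2) = 0

/-- The degree of a vertex in a simple graph. -/
def vdeg {V : Type*} (G : SimpleGraph V) (v : V) : ℕ := (G.neighborSet v).ncard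

/-- `M` is a matching in `G`: a set of edges of `G` that are pairwise non-adjacent. -/
def IsMatchingOn {V : Type*} (G : SimpleGraph V) (M : Set (Sym2 V)) : Prop :=
  M ⊆ G.edgeSet ∧ ∀ e ∈ M, ∀ f ∈ M, e ≠ f → ∀ v : V, v ∈ e → v ∉ f

/-- `G` is `k`-edge-colorable: its edge set is partitioned into `k` matchings. -/
def EdgeColorable {V : Type*} (G : SimpleGraph V) (k : ℕ) : Prop :=
  ∃ M : Fin k → Set (Sym2 V),
    (∀ i, IsMatchingOn G (M i)) ∧
    (∀ i j, i ≠ j → Disjoint (M i) (M j)) ∧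
    (⋃ i, M i) = G.edgeSet

/-- `p` is a straight-line RAC drawing of `G`: vertices are at pairwise distinct points,
each edge is the closed segment between its endpoints, no edge passes through another
vertex, edges sharing an endpoint meet only there, and any two edges with no common
endpoint that intersect do so orthogonally. -/
structure IsRACDrawing {V : Type*} (G : SimpleGraph V) (p : V → Pt) : Prop where
  inj : Function.Injective p
  vertex_off : ∀ u v w : V, G.Adj u v → w ≠ u → w ≠ v →
    p w ∉ segment ℝ (p u) (p v)
  shared : ∀ u v w : V, G.Adj u v → G.Adj u w → v ≠ w →
    segment ℝ (p u) (p v) ∩ segment ℝ (p u) (p w) ⊆ {p u}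
  rac : ∀ u v u' v' : V, G.Adj u v → G.Adj u' v' →
    u ≠ u' → u ≠ v' → v ≠ u' → v ≠ v' →
    (segment ℝ (p u) (p v) ∩ segment ℝ (p u') (p v')).Nonempty →
    SegOrth (p u) (p v) (p u') (p v')

/-- All points of `P` are integer grid points lying in an axis-aligned square
of side length `side`. -/
def InGridSquare (side : ℝ) (P : Set Pt) : Prop :=
  (∀ q ∈ P, ∃ a b : ℤ, q = ((a : ℝ), (b : ℝ))) ∧
  ∃ x0 y0 : ℝ, ∀ q ∈ P, x0 ≤ q.1 ∧ q.1 ≤ x0 + side ∧ y0 ≤ q.2 ∧ q.2 ≤ y0 + side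

/-- The list of consecutive segments (as pairs of endpoints) of a polyline given
by its list of points. -/
def polySegs (l : List Pt) : List (Pt × Pt) := l.zip l.tail

/-- The set of plane points covered by a polyline given by its list of points. -/
def polySet (l : List Pt) : Set Pt := ⋃ s ∈ polySegs l, segment ℝ s.1 s.2

/-- `p, poly` is a `k`-bend RAC drawing of `G`: each edge `e` is drawn as the polyline
through the list of points `poly e` (at most `k + 1` segments, i.e. at most `k + 2`
points) joining the two endpoints of `e`; no edge passes through another vertex; edges
sharing an endpoint meet only at that endpoint; any two distinct edges intersect in
finitely many points; and wherever segments of two distinct edges meet (other than at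
the point of a common endvertex) the two segments are orthogonal. -/
structure IsBendRACDrawing {V : Type*} (k : ℕ) (G : SimpleGraph V)
    (p : V → Pt) (poly : Sym2 V → List Pt) : Prop where
  inj : Function.Injective p
  ends : ∀ e ∈ G.edgeSet, ∃ u v : V, e = s(u, v) ∧
    (poly e).head? = some (p u) ∧ (poly e).getLast? = some (p v)
  nsegs : ∀ e ∈ G.edgeSet, 2 ≤ (poly e).length ∧ (poly e).length ≤ k + 2
  vertex_off : ∀ e ∈ G.edgeSet, ∀ w : V, w ∉ e → p w ∉ polySet (poly e)
  shared : ∀ e ∈ G.edgeSet, ∀ e' ∈ G.edgeSet, e ≠ e' → ∀ w : V, w ∈ e → w ∈ e' →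
    polySet (poly e) ∩ polySet (poly e') ⊆ {p w}
  fin_inter : ∀ e ∈ G.edgeSet, ∀ e' ∈ G.edgeSet, e ≠ e' →
    (polySet (poly e) ∩ polySet (poly e')).Finite
  rac : ∀ e ∈ G.edgeSet, ∀ e' ∈ G.edgeSet, e ≠ e' →
    ∀ s ∈ polySegs (poly e), ∀ s' ∈ polySegs (poly e'),
    ∀ x : Pt, x ∈ segment ℝ s.1 s.2 → x ∈ segment ℝ s'.1 s'.2 →
    (∀ w : V, w ∈ e → w ∈ e' → x ≠ p w) →
    SegOrth s.1 s.2 s'.1 s'.2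

/-- All vertex points and bend points of a polyline drawing. -/
def drawingPoints {V : Type*} (G : SimpleGraph V) (p : V → Pt)
    (poly : Sym2 V → List Pt) : Set Pt :=
  Set.range p ∪ {q | ∃ e ∈ G.edgeSet, q ∈ poly e}

/-- `F` is (the edge set of) a 2-factor of `G`: a spanning subgraph in which every
vertex has degree exactly 2. -/
def Is2Factor {V : Type*} (G : SimpleGraph V) (F : Set (Sym2 V)) : Prop :=
  F ⊆ G.edgeSet ∧ ∀ v : V, {e ∈ F | v ∈ e}.ncard = 2

/-- The connected components of the (2-regular) spanning subgraph with edge set `F`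
that are odd cycles, i.e. have an odd number of vertices. -/
def oddComps {V : Type*} (F : Set (Sym2 V)) :
    Set ((SimpleGraph.fromEdgeSet F).ConnectedComponent) :=
  {C | Odd C.supp.ncard}

/-- `G` has oddness `k`: the minimum over all 2-factors of the number of odd-cycle
components equals `k` (in particular a 2-factor exists). -/
def HasOddness {V : Type*} (G : SimpleGraph V) (k : ℕ) : Prop :=
  (∃ F, Is2Factor G F ∧ (oddComps F).ncard = k) ∧
  (∀ F, Is2Factor G F → k ≤ (oddComps F).ncard)

/-- `G` has no cut-edge. -/
def Bridgeless {V : Type*} (G : SimpleGraph V) : Prop := ∀ e, ¬ G.IsBridge e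

theorem rowLemma {α : Type*} [LinearOrder α] (m b : α → α) (hm : ∀ x, m (m x) = x)
    (hb : ∀ x, b (b x) = x) (hmb : ∀ x, m x ≠ b x)
    (hm1 : ∀ x, m x ≠ x) (hb1 : ∀ x, b x ≠ x) :
    ∀ N : ℕ, ∀ S : Finset α, S.card ≤ N → ∀ c d, c ∈ S → (∀ x ∈ S, m x ∈ S) →
    (∀ x ∈ S, x ≠ c → x ≠ d → b x ∈ S) → (b d ∈ S → b d = c) →
    (b c ∈ S → b c = d ∧ ∀ z ∈ S, c ≤ z) →
    ∃ ρ : α → ℕ, (∀ x ∈ S, ρ x < S.card) ∧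
      (∀ x ∈ S, ∀ y ∈ S, ρ x = ρ y → y = x ∨ y = m x) ∧
      (∀ x ∈ S, ρ (m x) = ρ x) ∧ ρ c = 0 ∧
      (∀ x ∈ S, b x ∈ S → x < b x → ∀ z ∈ S,
        (ρ x < ρ z ∧ ρ z < ρ (b x)) ∨ (ρ (b x) < ρ z ∧ ρ z < ρ x) →
        (z < x ∧ m z < x) ∨ (x < z ∧ x < m z)) := by
  intro N
  induction N with
  | zero =>
    intro S hS c d hc
    have := Finset.card_pos.mpr ⟨c, hc⟩
    omega
  | succ N ih =>
    intro S hS c d hc hSm hSb hd hcb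
    set S' := (S.erase c).erase (m c) with hS'
    have memS' : ∀ x, x ∈ S' ↔ x ≠ m c ∧ x ≠ c ∧ x ∈ S := by
      intro x; simp [hS']
    have hcard : S'.card < S.card := by
      apply Finset.card_lt_card
      refine ⟨fun x hx => ((memS' x).1 hx).2.2, fun h => ?_⟩
      exact ((memS' c).1 (h hc)).2.1 rfl
    have hS'm : ∀ x ∈ S', m x ∈ S' := by
      intro x hx
      rw [memS'] at hx ⊢
      refine ⟨fun h => hx.2.1 ?_, fun h => hx.1 ?_, hSm x hx.2.2⟩
      · rw [← hm x, h, hm]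
      · rw [← h, hm]
    have memS : ∀ x ∈ S, x = c ∨ x = m c ∨ x ∈ S' := by
      intro x hx
      rw [memS']; tauto
    by_cases hemp : S' = ∅
    · refine ⟨fun _ => 0, ?_, ?_, ?_, rfl, ?_⟩
      · intro x hx; exact Finset.card_pos.mpr ⟨c, hc⟩
      · intro x hx y hy _
        have h1 := memS x hx
        have h2 := memS y hy
        simp only [hemp, Finset.notMem_empty, or_false] at h1 h2
        rcases h1 with rfl | rfl <;> rcases h2 with rfl | rfl <;> simp [hm]
      · intro x hx; rfl
      · intro x hx _ _ z hz h; simp at h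
    · -- the main step
      have key : ∃ c' d', c' ∈ S' ∧ (∀ x ∈ S', x ≠ c' → x ≠ d' → b x ∈ S') ∧
          (b d' ∈ S' → b d' = c') ∧ (b c' ∈ S' → b c' = d' ∧ ∀ z ∈ S', c' ≤ z) ∧
          (b (m c) ∈ S → b (m c) = c') := by
        by_cases he : m c = d
        · have hcl : ∀ x ∈ S', b x ∈ S' := by
            intro x hx
            have hx' := (memS' x).1 hx
            have hbx := hSb x hx'.2.2 hx'.2.1 (by rw [← he]; exact hx'.1)
            rw [memS']
            refine ⟨fun h => ?_, fun h => ?_, hbx⟩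
            · have : x = b d := by rw [← he, ← h, hb]
              exact hx'.2.1 (by rw [this]; exact hd (this ▸ hx'.2.2))
            · have : x = b c := by rw [← h, hb]
              have h2 := (hcb (this ▸ hx'.2.2)).1
              exact hmb c (he.trans h2.symm)
          have hne := Finset.nonempty_iff_ne_empty.2 hemp
          refine ⟨S'.min' hne, b (S'.min' hne), Finset.min'_mem _ _, fun x hx _ _ => hcl x hx,
            fun _ => hb _, fun _ => ⟨rfl, fun z hz => Finset.min'_le _ _ hz⟩, ?_⟩
          intro h
          exfalso
          rw [he] at h
          have := hd h
          apply hmb c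
          rw [he, ← this, hb]
        · have h1 := hSb (m c) (hSm c hc) (hm1 c) he
          have h2 : b (m c) ∈ S' := by
            rw [memS']
            refine ⟨fun h => ?_, fun h => ?_, h1⟩
            · exact hb1 _ h
            · apply hmb c; rw [← hb (m c), h]
          refine ⟨b (m c), d, h2, ?_, ?_, ?_, fun _ => rfl⟩
          · intro x hx hx1 hx2
            have hx' := (memS' x).1 hx
            have hbx := hSb x hx'.2.2 hx'.2.1 hx2
            rw [memS']
            refine ⟨fun h => hx1 (by rw [← h, hb]), fun h => ?_, hbx⟩
            have : x = b c := by rw [← h, hb]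
            exact hx2 (by rw [this]; exact (hcb (this ▸ hx'.2.2)).1)
          · intro h
            exact absurd (hd ((memS' _).1 h).2.2) ((memS' _).1 h).2.1
          · rw [hb]; intro h
            exact absurd rfl ((memS' _).1 h).1
      obtain ⟨c', d', hc', k1, k2, k3, k4⟩ := key
      obtain ⟨ρ, r1, r2, r3, r4, r5⟩ := ih S' (by omega) c' d' hc' hS'm k1 k2 k3
      have hcS' : c ∉ S' := fun h => ((memS' _).1 h).2.1 rfl
      have heS' : m c ∉ S' := fun h => ((memS' _).1 h).1 rfl
      refine ⟨fun x => if x ∈ S' then ρ x + 1 else 0, ?_, ?_, ?_, ?_, ?_⟩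
      · intro x hx
        by_cases h : x ∈ S'
        · have := r1 x h
          simp only [h, if_true]; omega
        · simp only [h, if_false]; omega
      · intro x hx y hy hxy
        by_cases h : x ∈ S' <;> by_cases h' : y ∈ S' <;> simp only [h, h', if_true, if_false] at hxy
        · exact r2 x h y h' (by omega)
        · omega
        · omega
        · have h1 := memS x hx
          have h2 := memS y hy
          simp only [h, h', or_false] at h1 h2
          rcases h1 with rfl | rfl <;> rcases h2 with rfl | rfl <;> simp [hm]
      · intro x hx
        by_cases h : x ∈ S'
        · have := r3 x h
          simp only [h, hS'm x h, if_true, this]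
        · have : m x ∉ S' := fun h' => h (by rw [← hm x]; exact hS'm _ h')
          simp only [h, this, if_false]
      · simp [hcS']
      · intro x hx hbx hlt z hz hbet
        have hzS' : z ∈ S' := by
          by_contra h
          simp only [h, if_false] at hbet
          omega
        have hz' := (memS' z).1 hzS'
        by_cases h : x ∈ S' <;> by_cases h' : b x ∈ S'
        · simp only [h, h', hzS', if_true] at hbet
          exact r5 x h h' hlt z hzS' (by omega)
        · simp only [h, h', hzS', if_true, if_false] at hbet
          rcases memS _ hbx with h1 | h1 | h1
          · have : x = b c := by rw [← h1, hb]
            have h3 := (hcb (this ▸ hx)).2 x hx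
            rw [h1] at hlt
            exact absurd hlt (not_lt.2 h3)
          · have h2 : x = b (m c) := by rw [← h1, hb]
            have h3 := k4 (h2 ▸ hx)
            rw [h2, h3, r4] at hbet
            omega
          · exact absurd h1 h'
        · simp only [h, h', hzS', if_true, if_false] at hbet
          rcases memS _ hx with h1 | h1 | h1
          · rw [h1] at hbx ⊢
            have h3 := (hcb hbx).2
            right
            exact ⟨lt_of_le_of_ne (h3 z hz) (Ne.symm hz'.2.1),
              lt_of_le_of_ne (h3 _ (hSm z hz)) (Ne.symm ((memS' _).1 (hS'm z hzS')).2.1)⟩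
          · rw [h1] at hbx hbet
            rw [k4 hbx, r4] at hbet
            omega
          · exact absurd h1 h
        · simp only [h, h', hzS', if_true, if_false] at hbet
          omega

/-- cyclic neighbours -/
def Cyc {n : ℕ} (i j : Fin n) : Prop :=
  j.val = i.val + 1 ∨ i.val = j.val + 1 ∨ (i.val = 0 ∧ j.val = n - 1) ∨ (j.val = 0 ∧ i.val = n - 1)

theorem Cyc.symm {n : ℕ} {i j : Fin n} (h : Cyc i j) : Cyc j i := by
  unfold Cyc at *; tauto

theorem cyc_ncard {n : ℕ} (hn : 3 ≤ n) (i : Fin n) : {j | Cyc i j}.ncard = 2 := by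
  rw [Set.ncard_eq_two]
  have hi := i.2
  refine ⟨⟨if i.val + 1 < n then i.val + 1 else 0, by split_ifs <;> omega⟩,
    ⟨if i.val = 0 then n - 1 else i.val - 1, by split_ifs <;> omega⟩, ?_, ?_⟩
  · intro h
    rw [Fin.ext_iff] at h
    simp only at h
    split_ifs at h <;> omega
  · ext j
    have hj := j.2
    simp only [Cyc, Set.mem_ofPred_eq, Set.mem_insert_iff, Set.mem_singleton_iff, Fin.ext_iff]
    split_ifs <;> omega

theorem even_card {V : Type} [Fintype V] (G : SimpleGraph V) (h3 : ∀ v : V, vdeg G v = 3) :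
    Even (Fintype.card V) := by
  have h := G.sum_degrees_eq_twice_card_edges
  have : ∀ v, G.degree v = 3 := by
    intro v
    rw [← h3 v, vdeg, Set.ncard_eq_toFinset_card', SimpleGraph.degree, SimpleGraph.neighborFinset]
  simp only [this, Finset.sum_const, Finset.card_univ, smul_eq_mul] at h
  rw [Nat.even_iff]; omega

theorem extract {V : Type} [Fintype V] (G : SimpleGraph V) (h3 : ∀ v : V, vdeg G v = 3)
    (v : V) (w : G.Walk v v) (hw : w.IsHamiltonianCycle) :
    ∃ (n : ℕ) (f : Fin n ≃ V) (m : Fin n → Fin n), n = Fintype.card V ∧ 4 ≤ n ∧ Even n ∧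
      (∀ i, m (m i) = i) ∧ (∀ i, m i ≠ i) ∧ (∀ i, ¬ Cyc i (m i)) ∧
      (∀ i j, G.Adj (f i) (f j) → Cyc i j ∨ j = m i) := by
  have hlen : w.length = Fintype.card V := hw.length_eq
  have hn3 : 3 ≤ w.length := hw.isCycle.three_le_length
  have hev := even_card G h3
  rw [← hlen] at hev
  have hinj : Function.Injective (fun i : Fin w.length => w.getVert i.val) := by
    intro i j h
    have := hw.isCycle.getVert_injOn' (by simp; omega) (by simp; omega) h
    exact Fin.ext this
  have hbij : Function.Bijective (fun i : Fin w.length => w.getVert i.val) := by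
    rw [Fintype.bijective_iff_injective_and_card]
    exact ⟨hinj, by simp [hlen]⟩
  let f : Fin w.length ≃ V := Equiv.ofBijective _ hbij
  have hf : ∀ i, f i = w.getVert i.val := fun i => rfl
  have hadj : ∀ i j : Fin w.length, Cyc i j → G.Adj (f i) (f j) := by
    have h1 : ∀ i j : Fin w.length, j.val = i.val + 1 → G.Adj (f i) (f j) := by
      intro i j h
      rw [hf, hf, h]
      exact w.adj_getVert_succ i.2
    have h2 : ∀ i j : Fin w.length, j.val = 0 → i.val = w.length - 1 → G.Adj (f i) (f j) := by
      intro i j h h'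
      have := w.adj_getVert_succ i.2
      rw [hf, hf, h, w.getVert_zero]
      rwa [show i.val + 1 = w.length by omega, w.getVert_length] at this
    intro i j h
    rcases h with h | h | h | h
    · exact h1 _ _ h
    · exact (h1 _ _ h).symm
    · exact (h2 _ _ h.1 h.2).symm
    · exact h2 _ _ h.1 h.2
  have hone : ∀ i, ∃ j, {j | G.Adj (f i) (f j) ∧ ¬ Cyc i j} = {j} := by
    intro i
    rw [← Set.ncard_eq_one]
    have hA : {j | G.Adj (f i) (f j)}.ncard = 3 := by
      rw [← h3 (f i), vdeg]
      rw [← Set.ncard_image_of_injective _ f.injective]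
      congr 1
      ext x
      simp only [Set.mem_image, Set.mem_ofPred_eq, SimpleGraph.mem_neighborSet]
      constructor
      · rintro ⟨j, h, rfl⟩; exact h
      · intro h; exact ⟨f.symm x, by simpa using h, by simp⟩
    have h2 := cyc_ncard hn3 i
    have hd := Set.ncard_sdiff_add_ncard_of_subset (s := {j | Cyc i j})
      (t := {j | G.Adj (f i) (f j)}) (fun j hj => hadj i j hj) (Set.toFinite _)
    have : {j | G.Adj (f i) (f j) ∧ ¬ Cyc i j} = {j | G.Adj (f i) (f j)} \ {j | Cyc i j} := rfl
    rw [this]; omega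
  choose m hm using hone
  have hm' : ∀ i j, (G.Adj (f i) (f j) ∧ ¬ Cyc i j) ↔ j = m i := by
    intro i j
    have := Set.ext_iff.1 (hm i) j
    simpa using this
  refine ⟨w.length, f, m, hlen, ?_, hev, ?_, ?_, ?_, ?_⟩
  · rw [Nat.even_iff] at hev; omega
  · intro i
    have h := (hm' i (m i)).2 rfl
    exact ((hm' (m i) i).1 ⟨h.1.symm, fun hc => h.2 hc.symm⟩).symm
  · intro i h
    have h' := (hm' i (m i)).2 rfl
    rw [h] at h'
    exact G.loopless.irrefl _ h'.1
  · intro i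
    exact ((hm' i (m i)).2 rfl).2
  · intro i j h
    by_cases hc : Cyc i j
    · exact Or.inl hc
    · exact Or.inr ((hm' i j).1 ⟨h, hc⟩)

theorem seg_param {a b q : Pt} (h : q ∈ segment ℝ a b) :
    ∃ t : ℝ, 0 ≤ t ∧ t ≤ 1 ∧ q.1 = (1 - t) * a.1 + t * b.1 ∧ q.2 = (1 - t) * a.2 + t * b.2 := by
  obtain ⟨s, t, hs, ht, hst, rfl⟩ := h
  refine ⟨t, ht, by linarith, ?_, ?_⟩ <;>
  · simp only [Prod.fst_add, Prod.snd_add, Prod.smul_fst, Prod.smul_snd, smul_eq_mul]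
    rw [← hst]; ring

/-- The combinatorial facts on coordinates used to verify the drawing. -/
structure Lay {n : ℕ} (m : Fin n → Fin n) (o l : Fin n) (X Y : Fin n → ℝ) : Prop where
  mm : ∀ i, m (m i) = i
  mne : ∀ i, m i ≠ i
  mono : ∀ i j, i ≤ j → X i ≤ X j
  col : ∀ i j k, X i = X j → X i = X k → i = j ∨ i = k ∨ j = k
  row : ∀ i j, Y i = Y j → j = i ∨ j = m i
  rowm : ∀ i, i ≠ o → m i ≠ o → Y (m i) = Y i
  inj : ∀ i j, X i = X j → Y i = Y j → i = j
  Yo : Y o < 0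
  Yu : Y (m o) = 0
  Ypos : ∀ i, i ≠ o → i ≠ m o → 0 < Y i
  Xu : X o < X (m o)
  strip : ∀ i j : Fin n, j.val = i.val + 1 → X i < X j → i ≠ o → ∀ z, z ≠ o → m z ≠ o →
    (Y i < Y z ∧ Y z < Y j ∨ Y j < Y z ∧ Y z < Y i) →
    (X z ≤ X i ∧ X (m z) ≤ X i) ∨ (X j ≤ X z ∧ X j ≤ X (m z))
  stripY : ∀ i j : Fin n, j.val = i.val + 1 → X i < X j → i ≠ o → Y i ≠ Y j
  omin : ∀ i, o ≤ i
  W : ∃ A B C : ℝ, A * X o + B * Y o + C = 0 ∧ A * X l + B * Y l + C = 0 ∧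
    ∀ i, i ≠ o → i ≠ l → 0 < A * X i + B * Y i + C

def Meet {n : ℕ} (p : Fin n → Pt) (i j k l : Fin n) : Prop :=
  ∀ q, q ∈ segment ℝ (p i) (p j) → q ∈ segment ℝ (p k) (p l) →
    (∃ w, (w = i ∨ w = j) ∧ (w = k ∨ w = l) ∧ q = p w) ∨
    ((i ≠ k ∧ i ≠ l ∧ j ≠ k ∧ j ≠ l) ∧ SegOrth (p i) (p j) (p k) (p l))

theorem Meet.swap {n : ℕ} {p : Fin n → Pt} {i j k l : Fin n} (h : Meet p i j k l) :
    Meet p k l i j := by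
  intro q h1 h2
  rcases h q h2 h1 with ⟨w, hw1, hw2, hw3⟩ | ⟨⟨h1, h2, h3, h4⟩, h5⟩
  · exact Or.inl ⟨w, hw2, hw1, hw3⟩
  · refine Or.inr ⟨⟨h1.symm, h3.symm, h2.symm, h4.symm⟩, ?_⟩
    unfold SegOrth at *; linarith

theorem Meet.flip {n : ℕ} {p : Fin n → Pt} {i j k l : Fin n} (h : Meet p i j k l) :
    Meet p j i k l := by
  intro q h1 h2
  rw [segment_symm] at h1
  rcases h q h1 h2 with ⟨w, hw1, hw2, hw3⟩ | ⟨⟨h1, h2, h3, h4⟩, h5⟩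
  · exact Or.inl ⟨w, hw1.symm, hw2, hw3⟩
  · refine Or.inr ⟨⟨h3, h4, h1, h2⟩, ?_⟩
    unfold SegOrth at *; linarith

section
variable {n : ℕ} {m : Fin n → Fin n} {o l : Fin n} {X Y : Fin n → ℝ}

def EV (X : Fin n → ℝ) (i j : Fin n) : Prop := i ≠ j ∧ X i = X j
def EH (m : Fin n → Fin n) (o : Fin n) (i j : Fin n) : Prop := j = m i ∧ i ≠ o ∧ j ≠ o
def ES (o : Fin n) (X : Fin n → ℝ) (i j : Fin n) : Prop := j.val = i.val + 1 ∧ X i < X j ∧ i ≠ o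
def EU (m : Fin n → Fin n) (o : Fin n) (i j : Fin n) : Prop := i = o ∧ j = m o
def EW (o l : Fin n) (i j : Fin n) : Prop := i = o ∧ j = l

def P (X Y : Fin n → ℝ) (i : Fin n) : Pt := (X i, Y i)

theorem pt_eq {q : Pt} {i : Fin n} (h1 : q.1 = X i) (h2 : q.2 = Y i) : q = P X Y i :=
  Prod.ext h1 h2

/-- A point of a segment at the level of `i` for a functional which separates the end points. -/
theorem seg_V {q : Pt} {i j : Fin n} (h : EV X i j) (hq : q ∈ segment ℝ (P X Y i) (P X Y j)) :
    q.1 = X i := by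
  obtain ⟨t, h0, h1, hx, hy⟩ := seg_param hq
  simp only [P] at hx hy
  rw [hx, ← h.2]; ring

theorem seg_H (L : Lay m o l X Y) {q : Pt} {i j : Fin n} (h : EH m o i j)
    (hq : q ∈ segment ℝ (P X Y i) (P X Y j)) :
    q.2 = Y i ∧ Y j = Y i ∧ (q.1 ≤ X i ∨ q.1 ≤ X j) ∧ (X i ≤ q.1 ∨ X j ≤ q.1) := by
  obtain ⟨t, h0, h1, hx, hy⟩ := seg_param hq
  simp only [P] at hx hy
  have hY : Y j = Y i := by rw [h.1]; exact L.rowm i h.2.1 (h.1 ▸ h.2.2)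
  refine ⟨by rw [hy, hY]; ring, hY, ?_, ?_⟩
  · by_contra! hc
    rcases h0.eq_or_lt with h0 | h0
    · subst h0; linarith [hc.1]
    · nlinarith [mul_pos h0 (sub_pos.2 hc.2), mul_nonneg (sub_nonneg.2 h1) (sub_pos.2 hc.1).le]
  · by_contra! hc
    rcases h0.eq_or_lt with h0 | h0
    · subst h0; linarith [hc.1]
    · nlinarith [mul_pos h0 (sub_pos.2 hc.2), mul_nonneg (sub_nonneg.2 h1) (sub_pos.2 hc.1).le]

theorem seg_S (L : Lay m o l X Y) {q : Pt} {i j : Fin n} (h : ES o X i j)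
    (hq : q ∈ segment ℝ (P X Y i) (P X Y j)) :
    q = P X Y i ∨ q = P X Y j ∨
      (X i < q.1 ∧ q.1 < X j ∧ (Y i < q.2 ∧ q.2 < Y j ∨ Y j < q.2 ∧ q.2 < Y i)) := by
  obtain ⟨t, h0, h1, hx, hy⟩ := seg_param hq
  simp only [P] at hx hy
  rcases h0.eq_or_lt with h0 | h0
  · left; subst h0; exact pt_eq (by rw [hx]; ring) (by rw [hy]; ring)
  rcases h1.eq_or_lt with h1 | h1
  · right; left; subst h1; exact pt_eq (by rw [hx]; ring) (by rw [hy]; ring)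
  right; right
  have hX := h.2.1
  refine ⟨by nlinarith, by nlinarith, ?_⟩
  rcases lt_or_gt_of_ne (L.stripY i j h.1 h.2.1 h.2.2) with hY | hY
  · left; constructor <;> nlinarith
  · right; constructor <;> nlinarith

theorem seg_U (L : Lay m o l X Y) {q : Pt} {i j : Fin n} (h : EU m o i j)
    (hq : q ∈ segment ℝ (P X Y i) (P X Y j)) :
    q = P X Y o ∨ q = P X Y (m o) ∨ (X o < q.1 ∧ q.2 < 0) := by
  obtain ⟨t, h0, h1, hx, hy⟩ := seg_param hq
  obtain ⟨rfl, rfl⟩ := h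
  simp only [P] at hx hy
  have hX := L.Xu
  have hY := L.Yo
  rw [L.Yu] at hy
  rcases h0.eq_or_lt with h0 | h0
  · left; subst h0; exact pt_eq (by rw [hx]; ring) (by rw [hy]; ring)
  rcases h1.eq_or_lt with h1 | h1
  · right; left; subst h1; exact pt_eq (by rw [hx]; ring) (by rw [hy, L.Yu]; ring)
  right; right
  constructor <;> nlinarith

/-- Any segment avoiding the vertex `o` lies in the upper half plane. -/
theorem seg_up (L : Lay m o l X Y) {q : Pt} {i j : Fin n} (hij : i ≠ j) (hi : i ≠ o) (hj : j ≠ o)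
    (hq : q ∈ segment ℝ (P X Y i) (P X Y j)) :
    0 < q.2 ∨ (q = P X Y (m o) ∧ (m o = i ∨ m o = j)) := by
  obtain ⟨t, h0, h1, hx, hy⟩ := seg_param hq
  simp only [P] at hx hy
  by_cases hiu : i = m o
  · have hYj := L.Ypos j hj (by rw [← hiu]; exact hij.symm)
    rw [hiu, L.Yu] at hy
    rcases h0.eq_or_lt with h0 | h0
    · right; subst h0
      exact ⟨pt_eq (by rw [hx, hiu]; ring) (by rw [hy, L.Yu]; ring), Or.inl hiu.symm⟩
    · left; nlinarith
  · have hYi := L.Ypos i hi hiu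
    by_cases hju : j = m o
    · rw [hju, L.Yu] at hy
      rcases h1.eq_or_lt with h1 | h1
      · right; subst h1
        exact ⟨pt_eq (by rw [hx, hju]; ring) (by rw [hy, L.Yu]; ring), Or.inr hju.symm⟩
      · left; nlinarith
    · left
      have hYj := L.Ypos j hj hju
      by_contra! hc
      rcases h0.eq_or_lt with h0 | h0
      · subst h0; linarith
      · nlinarith [mul_pos h0 hYj, mul_nonneg (sub_nonneg.2 h1) hYi.le]

theorem meet_W (L : Lay m o l X Y) {i j a b : Fin n} (h : EW o l i j) (hab : a ≠ b)
    (hne : ¬ ((i = a ∧ j = b) ∨ (i = b ∧ j = a))) : Meet (P X Y) i j a b := by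
  obtain ⟨rfl, rfl⟩ := h
  intro q h1 h2
  left
  obtain ⟨A, B, C, hA, hB, hC⟩ := L.W
  obtain ⟨t, h0, h1, hx, hy⟩ := seg_param h1
  obtain ⟨s, h0', h1', hx', hy'⟩ := seg_param h2
  simp only [P] at hx hy hx' hy'
  have hf : A * q.1 + B * q.2 + C = 0 := by
    rw [hx, hy]; linear_combination (1 - t) * hA + t * hB
  have hf' : A * q.1 + B * q.2 + C =
      (1 - s) * (A * X a + B * Y a + C) + s * (A * X b + B * Y b + C) := by
    rw [hx', hy']; ring
  have key : ∀ c, (c = i ∨ c = j) → A * X c + B * Y c + C = 0 := by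
    rintro c (rfl | rfl) <;> assumption
  by_cases ha : a = i ∨ a = j
  · have hb : ¬ (b = i ∨ b = j) := by grind
    have := hC b (by tauto) (by tauto)
    rw [hf, key a ha] at hf'
    have hs : s = 0 := by
      have : s * (A * X b + B * Y b + C) = 0 := by linarith
      rcases mul_eq_zero.1 this with h | h
      · exact h
      · linarith
    subst hs
    exact ⟨a, ha, Or.inl rfl, pt_eq (by rw [hx']; ring) (by rw [hy']; ring)⟩
  · have hap := hC a (by tauto) (by tauto)
    by_cases hb : b = i ∨ b = j
    · rw [hf, key b hb] at hf'
      have hs : 1 - s = 0 := by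
        have : (1 - s) * (A * X a + B * Y a + C) = 0 := by linarith
        rcases mul_eq_zero.1 this with h | h
        · exact h
        · linarith
      have hs : s = 1 := by linarith
      subst hs
      exact ⟨b, hb, Or.inr rfl, pt_eq (by rw [hx']; ring) (by rw [hy']; ring)⟩
    · have hbp := hC b (by tauto) (by tauto)
      exfalso
      rw [hf] at hf'
      rcases h0'.eq_or_lt with h0 | h0
      · subst h0; linarith
      · nlinarith [mul_pos h0 hbp, mul_nonneg (sub_nonneg.2 h1') hap.le]

theorem meet_U (L : Lay m o l X Y) {i j a b : Fin n} (h : EU m o i j)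
    (hab : EV X a b ∨ EH m o a b ∨ ES o X a b) : Meet (P X Y) i j a b := by
  intro q h1 h2
  left
  have hS := seg_U L h h1
  have hne : a ≠ b := by
    rcases hab with h | h | h
    · exact h.1
    · rw [h.1]; exact (L.mne a).symm
    · intro hc; rw [hc] at h; have := h.1; omega
  have huo : m o ≠ o := L.mne o
  by_cases hao : a ≠ o ∧ b ≠ o
  · rcases seg_up L hne hao.1 hao.2 h2 with h3 | ⟨h3, h4⟩
    · exfalso
      rcases hS with rfl | rfl | hS
      · have := L.Yo; simp only [P] at h3; linarith
      · have := L.Yu; simp only [P] at h3; linarith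
      · linarith
    · exact ⟨m o, Or.inr h.2.symm, h4, h3⟩
  · have hV : EV X a b := by
      rcases hab with h | h | h
      · exact h
      · exact absurd h.2 hao
      · exfalso
        have hb : b = o := by
          by_contra hb
          exact hao ⟨h.2.2, hb⟩
        have := L.omin a
        rw [← hb, Fin.le_def] at this
        have := h.1
        omega
    have hXo : X a = X o := by
      by_cases ha : a = o
      · rw [ha]
      · have hb : b = o := by
          by_contra hb
          exact hao ⟨ha, hb⟩
        rw [hV.2, hb]
    have hq := seg_V hV h2
    rcases hS with rfl | rfl | hS
    · refine ⟨o, Or.inl h.1.symm, ?_, rfl⟩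
      by_contra! hc
      exact hao ⟨hc.1.symm, hc.2.symm⟩
    · have := L.Xu; simp only [P] at hq; linarith
    · linarith

theorem meet_VV (L : Lay m o l X Y) {i j a b : Fin n} (h : EV X i j) (h' : EV X a b)
    (hne : ¬ ((i = a ∧ j = b) ∨ (i = b ∧ j = a))) : Meet (P X Y) i j a b := by
  intro q h1 h2
  exfalso
  have e1 := seg_V h h1
  have e2 := seg_V h' h2
  have h3 := L.col i j a h.2 (by linarith)
  have h4 := L.col i j b h.2 (by linarith [h'.2])
  have := h.1
  have := h'.1
  grind

theorem meet_VH (L : Lay m o l X Y) {i j a b : Fin n} (h : EV X i j) (h' : EH m o a b) :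
    Meet (P X Y) i j a b := by
  intro q h1 h2
  have e1 := seg_V h h1
  obtain ⟨e2, e3, -, -⟩ := seg_H L h' h2
  by_cases hc : i ≠ a ∧ i ≠ b ∧ j ≠ a ∧ j ≠ b
  · refine Or.inr ⟨hc, ?_⟩
    simp only [SegOrth, P, e3, h.2]; ring
  · left
    have : (i = a ∨ i = b) ∨ (j = a ∨ j = b) := by tauto
    rcases this with hi | hj
    · refine ⟨i, Or.inl rfl, hi, pt_eq e1 ?_⟩
      rcases hi with rfl | rfl <;> linarith
    · refine ⟨j, Or.inr rfl, hj, pt_eq (by linarith [h.2]) ?_⟩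
      rcases hj with rfl | rfl <;> linarith

theorem meet_HH (L : Lay m o l X Y) {i j a b : Fin n} (h : EH m o i j) (h' : EH m o a b)
    (hne : ¬ ((i = a ∧ j = b) ∨ (i = b ∧ j = a))) : Meet (P X Y) i j a b := by
  intro q h1 h2
  exfalso
  obtain ⟨e1, -, -, -⟩ := seg_H L h h1
  obtain ⟨e2, -, -, -⟩ := seg_H L h' h2
  have h3 := L.row i a (by linarith)
  have := L.mm i
  have := h.1
  have := h'.1
  grind

theorem meet_VS (L : Lay m o l X Y) {i j a b : Fin n} (h : EV X i j) (h' : ES o X a b) :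
    Meet (P X Y) i j a b := by
  intro q h1 h2
  left
  have e1 := seg_V h h1
  have hij := h.1
  have key : ∀ c, X i = X c → c = i ∨ c = j := by
    intro c hc
    have := L.col i j c h.2 hc
    grind
  rcases seg_S L h' h2 with rfl | rfl | ⟨h3, h4, -⟩
  · exact ⟨a, key a e1.symm, Or.inl rfl, rfl⟩
  · exact ⟨b, key b e1.symm, Or.inr rfl, rfl⟩
  · exfalso
    rw [e1] at h3 h4
    have hab := h'.1
    rcases le_or_gt i a with hc | hc
    · linarith [L.mono i a hc]
    · have : b ≤ i := by
        rw [Fin.le_def]; rw [Fin.lt_def] at hc; omega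
      linarith [L.mono b i this]

theorem meet_HS (L : Lay m o l X Y) {i j a b : Fin n} (h : EH m o i j) (h' : ES o X a b) :
    Meet (P X Y) i j a b := by
  intro q h1 h2
  left
  obtain ⟨e1, e2, e3, e4⟩ := seg_H L h h1
  have hj := h.1
  have key : ∀ c, Y i = Y c → c = i ∨ c = j := by
    intro c hc
    have := L.row i c hc
    rw [hj]; exact this
  rcases seg_S L h' h2 with rfl | rfl | ⟨h3, h4, h5⟩
  · exact ⟨a, key a e1.symm, Or.inl rfl, rfl⟩
  · exact ⟨b, key b e1.symm, Or.inr rfl, rfl⟩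
  · exfalso
    rw [e1] at h5
    have h6 := L.strip a b h'.1 h'.2.1 h'.2.2 i h.2.1 (hj ▸ h.2.2) h5
    rw [← hj] at h6
    rcases h6 with ⟨h6, h7⟩ | ⟨h6, h7⟩
    · rcases e3 with e | e <;> linarith
    · rcases e4 with e | e <;> linarith

theorem meet_SS_aux (L : Lay m o l X Y) {i j a b : Fin n} (h : ES o X i j) (h' : ES o X a b)
    (hlt : i < a) : Meet (P X Y) i j a b := by
  intro q h1 h2
  left
  have hja : j ≤ a := by
    rw [Fin.le_def]; rw [Fin.lt_def] at hlt; have := h.1; omega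
  have hX := L.mono _ _ hja
  have s1 := h.2.1
  have s2 := h'.2.1
  rcases seg_S L h h1 with rfl | rfl | ⟨h3, h4, -⟩ <;>
    rcases seg_S L h' h2 with e | e | ⟨h3', h4', -⟩
  · have := congrArg Prod.fst e; simp only [P] at this; linarith
  · have := congrArg Prod.fst e; simp only [P] at this; linarith
  · simp only [P] at h3' h4'; linarith
  · have h6 := congrArg Prod.fst e
    have h7 := congrArg Prod.snd e
    simp only [P] at h6 h7
    exact ⟨j, Or.inr rfl, Or.inl (L.inj _ _ h6 h7), rfl⟩
  · have := congrArg Prod.fst e; simp only [P] at this; linarith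
  · simp only [P] at h3' h4'; linarith
  · have := congrArg Prod.fst e; simp only [P] at this; linarith
  · have := congrArg Prod.fst e; simp only [P] at this; linarith
  · linarith

theorem meet_SS (L : Lay m o l X Y) {i j a b : Fin n} (h : ES o X i j) (h' : ES o X a b)
    (hne : ¬ ((i = a ∧ j = b) ∨ (i = b ∧ j = a))) : Meet (P X Y) i j a b := by
  rcases lt_trichotomy i a with hc | hc | hc
  · exact meet_SS_aux L h h' hc
  · exfalso
    apply hne
    left
    refine ⟨hc, Fin.ext ?_⟩
    rw [h.1, h'.1, hc]
  · exact (meet_SS_aux L h' h hc).swap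

def EE (m : Fin n → Fin n) (o l : Fin n) (X : Fin n → ℝ) (i j : Fin n) : Prop :=
  EV X i j ∨ EH m o i j ∨ ES o X i j ∨ EU m o i j ∨ EW o l i j

theorem EE.ne (L : Lay m o l X Y) (hol : o ≠ l) {i j : Fin n} (h : EE m o l X i j) : i ≠ j := by
  rcases h with h | h | h | h | h
  · exact h.1
  · rw [h.1]; exact (L.mne i).symm
  · intro hc; rw [hc] at h; have := h.1; omega
  · rw [h.1, h.2]; exact (L.mne o).symm
  · rw [h.1, h.2]; exact hol

theorem meet_all (L : Lay m o l X Y) (hol : o ≠ l) {i j a b : Fin n}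
    (h : EE m o l X i j) (h' : EE m o l X a b)
    (hne : ¬ ((i = a ∧ j = b) ∨ (i = b ∧ j = a))) : Meet (P X Y) i j a b := by
  have d1 := h.ne L hol
  have d2 := h'.ne L hol
  have hne' : ¬ ((a = i ∧ b = j) ∨ (a = j ∧ b = i)) := by grind
  rcases h with h | h | h | h | h <;> rcases h' with h' | h' | h' | h' | h'
  · exact meet_VV L h h' hne
  · exact meet_VH L h h'
  · exact meet_VS L h h'
  · exact (meet_U L h' (Or.inl h)).swap
  · exact (meet_W L h' d1 hne').swap
  · exact (meet_VH L h' h).swap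
  · exact meet_HH L h h' hne
  · exact meet_HS L h h'
  · exact (meet_U L h' (Or.inr (Or.inl h))).swap
  · exact (meet_W L h' d1 hne').swap
  · exact (meet_VS L h' h).swap
  · exact (meet_HS L h' h).swap
  · exact meet_SS L h h' hne
  · exact (meet_U L h' (Or.inr (Or.inr h))).swap
  · exact (meet_W L h' d1 hne').swap
  · exact meet_U L h (Or.inl h')
  · exact meet_U L h (Or.inr (Or.inl h'))
  · exact meet_U L h (Or.inr (Or.inr h'))
  · exact absurd (Or.inl ⟨h.1.trans h'.1.symm, h.2.trans h'.2.symm⟩) hne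
  · exact (meet_W L h' d1 hne').swap
  all_goals exact meet_W L h d2 hne

theorem off_all (L : Lay m o l X Y) {i j w : Fin n} (h : EE m o l X i j)
    (hi : w ≠ i) (hj : w ≠ j) : P X Y w ∉ segment ℝ (P X Y i) (P X Y j) := by
  intro hq
  have Pinj : ∀ a b, P X Y a = P X Y b → a = b := fun a b e =>
    L.inj a b (congrArg Prod.fst e) (congrArg Prod.snd e)
  rcases h with h | h | h | h | h
  · have e := seg_V h hq
    simp only [P] at e
    have := L.col i j w h.2 e.symm
    have := h.1
    grind
  · obtain ⟨e, -, -, -⟩ := seg_H L h hq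
    simp only [P] at e
    have := L.row i w e.symm
    have := h.1
    grind
  · rcases seg_S L h hq with e | e | ⟨h3, h4, -⟩
    · exact hi (Pinj _ _ e)
    · exact hj (Pinj _ _ e)
    · simp only [P] at h3 h4
      have hab := h.1
      rcases le_or_gt w i with hc | hc
      · linarith [L.mono w i hc]
      · have : j ≤ w := by
          rw [Fin.le_def]; rw [Fin.lt_def] at hc; omega
        linarith [L.mono j w this]
  · rcases seg_U L h hq with e | e | ⟨h3, h4⟩
    · exact hi ((Pinj _ _ e).trans h.1.symm)
    · exact hj ((Pinj _ _ e).trans h.2.symm)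
    · simp only [P] at h4
      have := L.Ypos w (by rw [← h.1]; exact hi) (by rw [← h.2]; exact hj)
      linarith
  · obtain ⟨rfl, rfl⟩ := h
    obtain ⟨A, B, C, hA, hB, hC⟩ := L.W
    obtain ⟨t, h0, h1, hx, hy⟩ := seg_param hq
    simp only [P] at hx hy
    have := hC w hi hj
    rw [hx, hy] at this
    have h2 : A * ((1 - t) * X i + t * X j) + B * ((1 - t) * Y i + t * Y j) + C = 0 := by
      linear_combination (1 - t) * hA + t * hB
    linarith

end

section
variable {n : ℕ}

/-- The matching on the Hamiltonian cycle which contains the edge joining `n - 1` and `0`. -/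
def bmap (hn : 4 ≤ n) (i : Fin n) : Fin n :=
  ⟨if i.val = 0 then n - 1 else if i.val = n - 1 then 0 else
    if i.val % 2 = 1 then i.val + 1 else i.val - 1, by
    have := i.2
    split_ifs <;> omega⟩

def xN (i : Fin n) : ℕ := if i.val = n - 1 then 4 * n else i.val / 2

def yZ (ρ : Fin n → ℕ) (i : Fin n) : ℤ := if i.val = 0 then -(n : ℤ) else ρ i

theorem exists_lay (hn : 4 ≤ n) (hev : Even n) (m : Fin n → Fin n) (hm : ∀ i, m (m i) = i)
    (hm1 : ∀ i, m i ≠ i) (hmc : ∀ i, ¬ Cyc i (m i)) :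
    ∃ ρ : Fin n → ℕ, (∀ i, ρ i < n) ∧
      Lay m ⟨0, by omega⟩ ⟨n - 1, by omega⟩ (fun i => (xN i : ℝ)) (fun i => (yZ ρ i : ℝ)) := by
  rw [Nat.even_iff] at hev
  have bval : ∀ i : Fin n, (i.val = 0 ∧ (bmap hn i).val = n - 1) ∨
      (i.val = n - 1 ∧ (bmap hn i).val = 0) ∨
      (i.val ≠ 0 ∧ i.val ≠ n - 1 ∧ i.val % 2 = 1 ∧ (bmap hn i).val = i.val + 1) ∨
      (i.val ≠ 0 ∧ i.val ≠ n - 1 ∧ i.val % 2 = 0 ∧ (bmap hn i).val = i.val - 1) := by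
    intro i
    simp only [bmap]
    split_ifs <;> omega
  have hb : ∀ i, bmap hn (bmap hn i) = i := by
    intro i
    apply Fin.ext
    have := i.2
    have h1 := bval i
    have h2 := bval (bmap hn i)
    omega
  have hb1 : ∀ i, bmap hn i ≠ i := by
    intro i h
    have := i.2
    have h := congrArg Fin.val h
    simp only [bmap] at h
    split_ifs at h <;> omega
  have hcb : ∀ i, Cyc i (bmap hn i) := by
    intro i
    have := i.2
    simp only [Cyc, bmap]
    split_ifs <;> omega
  have hmb : ∀ i, m i ≠ bmap hn i := by
    intro i h
    exact hmc i (h ▸ hcb i)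
  obtain ⟨ρ, r1, r2, r3, r4, r5⟩ := rowLemma m (bmap hn) hm hb hmb hm1 hb1 n Finset.univ (by simp)
    ⟨0, by omega⟩ ⟨n - 1, by omega⟩ (Finset.mem_univ _) (fun _ _ => Finset.mem_univ _)
    (fun _ _ _ _ => Finset.mem_univ _)
    (fun _ => by
      apply Fin.ext
      simp only [bmap]
      split_ifs <;> omega)
    (fun _ => ⟨by
      apply Fin.ext
      simp only [bmap]
      split_ifs <;> omega, fun z _ => by simp [Fin.le_def]⟩)
  simp only [Finset.mem_univ, forall_const, Finset.card_univ, Fintype.card_fin]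
    at r1 r2 r3 r5
  set o : Fin n := ⟨0, by omega⟩ with ho
  set l : Fin n := ⟨n - 1, by omega⟩ with hl
  have ov : ∀ i : Fin n, i = o ↔ i.val = 0 := fun i => by rw [Fin.ext_iff]
  have lv : ∀ i : Fin n, i = l ↔ i.val = n - 1 := fun i => by rw [Fin.ext_iff]
  have hov : o.val = 0 := rfl
  have hlv : l.val = n - 1 := rfl
  have yo : yZ ρ o = -(n : ℤ) := by simp [yZ, ho]
  have yn : ∀ i, i ≠ o → yZ ρ i = ρ i := by
    intro i hi
    rw [Ne, ov] at hi
    simp [yZ, hi]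
  have mono : ∀ i j : Fin n, i ≤ j → xN i ≤ xN j := by
    intro i j h
    rw [Fin.le_def] at h
    have := j.2
    simp only [xN]
    split_ifs <;> omega
  have row : ∀ i j : Fin n, yZ ρ i = yZ ρ j → j = i ∨ j = m i := by
    intro i j h
    by_cases hi : i = o <;> by_cases hj : j = o
    · left; rw [hi, hj]
    · rw [hi, yo, yn j hj] at h; omega
    · rw [hj, yo, yn i hi] at h; omega
    · rw [yn i hi, yn j hj] at h
      exact r2 i j (by omega)
  have rho0 : ∀ i, ρ i = 0 → i = o ∨ i = m o := by
    intro i h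
    exact r2 o i (by rw [r4, h])
  have xrow : ∀ i j : Fin n, j.val = i.val + 1 → yZ ρ i ≠ yZ ρ j := by
    intro i j h he
    rcases row i j he with h1 | h1
    · rw [h1] at h; omega
    · exact hmc i (by rw [← h1]; exact Or.inl h)
  have mo2 : 2 ≤ (m o).val ∧ (m o).val ≠ n - 1 := by
    have h1 := hmc o
    have h2 := hm1 o
    rw [Ne, ov] at h2
    have h3 := (m o).2
    simp only [Cyc] at h1
    omega
  refine ⟨ρ, r1, ?_⟩
  constructor
  · exact hm
  · exact hm1
  · intro i j h; exact_mod_cast mono i j h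
  · intro i j k h1 h2
    have h1 : xN i = xN j := by exact_mod_cast h1
    have h2 : xN i = xN k := by exact_mod_cast h2
    have := i.2
    have := j.2
    have := k.2
    simp only [xN] at h1 h2
    simp only [Fin.ext_iff]
    split_ifs at h1 h2 <;> omega
  · intro i j h
    exact row i j (by exact_mod_cast h)
  · intro i h1 h2
    rw [yn _ h1, yn _ h2, r3]
  · intro i j h1 h2
    have h1 : xN i = xN j := by exact_mod_cast h1
    have h2 : yZ ρ i = yZ ρ j := by exact_mod_cast h2
    by_contra hne
    have hi := i.2
    have hj := j.2
    rw [Fin.ext_iff] at hne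
    have : j.val = i.val + 1 ∨ i.val = j.val + 1 := by
      simp only [xN] at h1
      split_ifs at h1 <;> omega
    rcases this with h | h
    · exact xrow i j h h2
    · exact xrow j i h h2.symm
  · simp only [yo]
    have : 0 < (n : ℝ) := by exact_mod_cast (by omega : 0 < n)
    push_cast; linarith
  · rw [yn _ (hm1 o), r3, r4]; simp
  · intro i h1 h2
    rw [yn _ h1]
    have : ρ i ≠ 0 := fun h => by
      rcases rho0 i h with h | h
      · exact h1 h
      · exact h2 h
    exact_mod_cast Nat.pos_of_ne_zero this
  · have : xN o < xN (m o) := by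
      simp only [xN]
      split_ifs <;> omega
    exact_mod_cast this
  · intro i j hij hX hio z hzo hmzo hbet
    have hX : xN i < xN j := by exact_mod_cast hX
    have hjo : j ≠ o := by rw [Ne, ov]; omega
    simp only [yn i hio, yn j hjo, yn z hzo] at hbet
    have hbet : (ρ i < ρ z ∧ ρ z < ρ j) ∨ (ρ j < ρ z ∧ ρ z < ρ i) := by exact_mod_cast hbet
    have goal : (xN z ≤ xN i ∧ xN (m z) ≤ xN i) ∨ (xN j ≤ xN z ∧ xN j ≤ xN (m z)) := by
      have hi0 : i.val ≠ 0 := fun h => hio ((ov i).2 h)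
      have hj2 := j.2
      by_cases hjl : j.val = n - 1
      · left
        have hz : z ≠ j := by rintro rfl; omega
        have hmz : m z ≠ j := by
          intro h
          have := r3 z
          rw [h] at this; omega
        rw [Ne, Fin.ext_iff] at hz hmz
        have := z.2
        have := (m z).2
        refine ⟨mono _ _ ?_, mono _ _ ?_⟩ <;> rw [Fin.le_def] <;> omega
      · have hodd : i.val % 2 = 1 := by
          simp only [xN] at hX
          split_ifs at hX <;> omega
        have hbi : bmap hn i = j := by
          apply Fin.ext
          simp only [bmap]
          split_ifs <;> omega
        have h5 := r5 i (by rw [hbi, Fin.lt_def]; omega) z (by rw [hbi]; exact hbet)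
        simp only [Fin.lt_def] at h5
        rcases h5 with h5 | h5
        · left
          refine ⟨mono _ _ ?_, mono _ _ ?_⟩ <;> rw [Fin.le_def] <;> omega
        · right
          refine ⟨mono _ _ ?_, mono _ _ ?_⟩ <;> rw [Fin.le_def] <;> omega
    exact_mod_cast goal
  · intro i j hij _ _ h
    exact xrow i j hij (by exact_mod_cast h)
  · intro i; simp [ho, Fin.le_def]
  · refine ⟨-((n : ℝ) + ρ l), 4 * n, 4 * n * n, ?_, ?_, ?_⟩
    · have : xN o = 0 := by
        simp only [xN]
        split_ifs <;> omega
      simp only [this, yo]; push_cast; ring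
    · have hlo : l ≠ o := by rw [Ne, ov]; omega
      have : xN l = 4 * n := by simp [xN, hl]
      simp only [this, yn l hlo]; push_cast; ring
    · intro i hio hil
      rw [Ne, lv] at hil
      have h2 : 2 * xN i ≤ n := by
        have := i.2
        simp only [xN, hil, if_false]; omega
      simp only [yn i hio]
      have h2' : 2 * (xN i : ℝ) ≤ n := by exact_mod_cast h2
      have h3 : (ρ l : ℝ) ≤ n := by exact_mod_cast (r1 l).le
      have h4 : (4 : ℝ) ≤ n := by exact_mod_cast hn
      have h5 : (0 : ℝ) ≤ ρ i := Nat.cast_nonneg _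
      have h6 : (0 : ℝ) ≤ xN i := Nat.cast_nonneg _
      push_cast
      nlinarith [mul_nonneg h6 (sub_nonneg.2 h3), mul_nonneg (by linarith : (0:ℝ) ≤ n) h5,
        mul_nonneg (by linarith : (0:ℝ) ≤ n) (sub_nonneg.2 h2')]

theorem edge_class {n : ℕ} (hn : 4 ≤ n) {m : Fin n → Fin n} {o l : Fin n} {Y : Fin n → ℝ}
    (ho : o.val = 0) (hl : l.val = n - 1)
    (L : Lay m o l (fun i => (xN i : ℝ)) Y) {i j : Fin n} (h : Cyc i j ∨ j = m i) :
    EE m o l (fun i => (xN i : ℝ)) i j ∨ EE m o l (fun i => (xN i : ℝ)) j i := by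
  have hsucc : ∀ i j : Fin n, j.val = i.val + 1 → EE m o l (fun i => (xN i : ℝ)) i j := by
    intro i j h
    have hij : i ≠ j := by rw [Ne, Fin.ext_iff]; omega
    rcases (L.mono i j (by rw [Fin.le_def]; omega)).eq_or_lt with he | hlt
    · exact Or.inl ⟨hij, he⟩
    · refine Or.inr (Or.inr (Or.inl ⟨h, hlt, ?_⟩))
      intro hio
      have hi0 : i.val = 0 := by rw [hio, ho]
      have hlt : xN i < xN j := by exact_mod_cast hlt
      simp only [xN] at hlt
      split_ifs at hlt <;> omega
  rcases h with (h | h | h | h) | h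
  · exact Or.inl (hsucc i j h)
  · exact Or.inr (hsucc j i h)
  · left; right; right; right; right
    exact ⟨Fin.ext (by omega), Fin.ext (by omega)⟩
  · right; right; right; right; right
    exact ⟨Fin.ext (by omega), Fin.ext (by omega)⟩
  · by_cases hi : i = o
    · left; right; right; right; left
      exact ⟨hi, by rw [h, hi]⟩
    · by_cases hj : j = o
      · right; right; right; right; left
        exact ⟨hj, by rw [← hj, h, L.mm]⟩
      · left; right; left
        exact ⟨h, hi, hj⟩

end

/-- There is an absolute constant `c` such that every 3-regular graph
on `n` vertices that has a Hamiltonian cycle admits a straight-line RAC drawing with all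
vertices on integer grid points inside a square of side `c * n` (i.e. of `O(n²)` area). -/
theorem stmt12 :
    ∃ c : ℝ, 0 < c ∧
      ∀ (V : Type) [Fintype V] (G : SimpleGraph V),
        (∀ v : V, vdeg G v = 3) →
        (∃ (v : V) (w : G.Walk v v), w.IsHamiltonianCycle) →
        ∃ p : V → Pt, IsRACDrawing G p ∧
          InGridSquare (c * (Fintype.card V : ℝ)) (Set.range p) := by
  refine ⟨5, by norm_num, ?_⟩
  intro V _ G h3 ⟨v, w, hw⟩
  obtain ⟨n, f, m, hcard, hn, hev, hm, hm1, hmc, hadj⟩ := extract G h3 v w hw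
  obtain ⟨ρ, hρ, L⟩ := exists_lay hn hev m hm hm1 hmc
  have hol : (⟨0, by omega⟩ : Fin n) ≠ ⟨n - 1, by omega⟩ := by
    rw [Ne, Fin.ext_iff]; simp only; omega
  set X : Fin n → ℝ := fun i => (xN i : ℝ) with hX
  set Y : Fin n → ℝ := fun i => (yZ ρ i : ℝ) with hY
  have hcl : ∀ a b : V, G.Adj a b → EE m ⟨0, by omega⟩ ⟨n - 1, by omega⟩ X (f.symm a) (f.symm b) ∨
      EE m ⟨0, by omega⟩ ⟨n - 1, by omega⟩ X (f.symm b) (f.symm a) := by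
    intro a b hab
    exact edge_class hn rfl rfl L (hadj _ _ (by simpa using hab))
  have Pinj : ∀ a b, P X Y a = P X Y b → a = b := fun a b e =>
    L.inj a b (congrArg Prod.fst e) (congrArg Prod.snd e)
  have hmeet : ∀ a b c d : V, G.Adj a b → G.Adj c d → ¬ ((a = c ∧ b = d) ∨ (a = d ∧ b = c)) →
      Meet (P X Y) (f.symm a) (f.symm b) (f.symm c) (f.symm d) := by
    intro a b c d hab hcd hne
    have hne1 : ¬ ((f.symm a = f.symm c ∧ f.symm b = f.symm d) ∨
        (f.symm a = f.symm d ∧ f.symm b = f.symm c)) := by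
      simpa only [f.symm.injective.eq_iff] using hne
    rcases hcl a b hab with h1 | h1 <;> rcases hcl c d hcd with h2 | h2
    · exact meet_all L hol h1 h2 (by tauto)
    · exact (meet_all L hol h1 h2 (by tauto)).swap.flip.swap
    · exact (meet_all L hol h1 h2 (by tauto)).flip
    · exact (meet_all L hol h1 h2 (by tauto)).flip.swap.flip.swap
  refine ⟨fun a => P X Y (f.symm a), ⟨?_, ?_, ?_, ?_⟩, ?_, ?_⟩
  · intro a b h
    exact f.symm.injective (Pinj _ _ h)
  · intro a b c hab h1 h2
    have h1' := f.symm.injective.ne h1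
    have h2' := f.symm.injective.ne h2
    rcases hcl a b hab with h | h
    · exact off_all L h h1' h2'
    · rw [segment_symm]
      exact off_all L h h2' h1'
  · rintro a b c hab hac hbc q ⟨hq1, hq2⟩
    have hab' := f.symm.injective.ne hab.ne
    have hac' := f.symm.injective.ne hac.ne
    have hbc' := f.symm.injective.ne hbc
    rcases hmeet a b a c hab hac (by
      rintro (h | h)
      · exact hbc h.2
      · exact hab.ne h.2.symm) q hq1 hq2 with ⟨z, hz1, hz2, hz3⟩ | ⟨h, -⟩
    · have : z = f.symm a := by
        rcases hz1 with h | h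
        · exact h
        · rcases hz2 with h' | h'
          · exact h'
          · exact absurd (h.symm.trans h') hbc'
      rw [Set.mem_singleton_iff, hz3, this]
    · exact absurd rfl h.1
  · rintro a b c d hab hcd h1 h2 h3 h4 ⟨q, hq1, hq2⟩
    have h1' := f.symm.injective.ne h1
    have h2' := f.symm.injective.ne h2
    have h3' := f.symm.injective.ne h3
    have h4' := f.symm.injective.ne h4
    rcases hmeet a b c d hab hcd (by tauto) q hq1 hq2 with ⟨z, hz1, hz2, hz3⟩ | ⟨-, h⟩
    · exfalso
      rcases hz1 with rfl | rfl <;> tauto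
    · exact h
  · rintro q ⟨a, rfl⟩
    exact ⟨(xN (f.symm a) : ℤ), yZ ρ (f.symm a), by simp [P, hX, hY]⟩
  · refine ⟨-n, -n, ?_⟩
    rintro q ⟨a, rfl⟩
    rw [← hcard]
    have hx : xN (f.symm a) ≤ 4 * n := by
      have := (f.symm a).2
      simp only [xN]
      split_ifs <;> omega
    have hy : -(n : ℤ) ≤ yZ ρ (f.symm a) ∧ yZ ρ (f.symm a) ≤ n := by
      have := hρ (f.symm a)
      simp only [yZ]
      split_ifs <;> omega
    have hx' : (xN (f.symm a) : ℝ) ≤ 4 * n := by exact_mod_cast hx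
    have hy1 : -(n : ℝ) ≤ (yZ ρ (f.symm a) : ℝ) := by exact_mod_cast hy.1
    have hy2 : (yZ ρ (f.symm a) : ℝ) ≤ (n : ℝ) := by exact_mod_cast hy.2
    have hx0 : (0 : ℝ) ≤ (xN (f.symm a) : ℝ) := Nat.cast_nonneg _
    have hn0 : (0 : ℝ) ≤ (n : ℝ) := Nat.cast_nonneg _
    simp only [P, hX, hY]
    refine ⟨?_, ?_, ?_, ?_⟩ <;> linarith
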